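/- Let a = (a1, a2, a3) ∈ ℝ³, set a0 = sqrt(1 + |a|²), let ω ∈ ℝ³ with |ω| = 1, and set u = a1·ω1 + a2·ω2 + a3·ω3. Let b0, b be real numbers and let H0, H, D, W : [r0, ∞) → ℝ satisfy, as r → ∞: H0(r) = 2/r + b0/r² + O(r⁻³), H(r) = 2/r + b/r² + O(r⁻³), D(r) = 2u/r + O(r⁻²), and W(r) = (a0)² − 1 − u² + O(r⁻¹). Define ρ(r) = ( sqrt( H0(r)² + D(r)²/(1 + W(r)) ) − sqrt( H(r)² + D(r)²/(1 + W(r)) ) ) / sqrt(1 + W(r)) for large r. Then ρ(r) = (b0 − b)/(a0 · r²) + O(r⁻³) as r → ∞. -/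

import Mathlib

open scoped BigOperators

/-- `BigO g k r1` means `g r = O(r^k)` as `r → ∞`:
there exist `C > 0` and `r2 ≥ r1` such that `|g r| ≤ C * r ^ k` for all `r ≥ r2`. -/
def BigO (g : ℝ → ℝ) (k : ℤ) (r1 : ℝ) : Prop :=
  ∃ C > (0 : ℝ), ∃ r2 ≥ r1, ∀ r ≥ r2, |g r| ≤ C * r ^ k

open Filter Topology Asymptotics

lemma bigO_iff_aux (g : ℝ → ℝ) (k : ℤ) (r1 : ℝ) :
    BigO g k r1 ↔ g =O[atTop] (fun r : ℝ => r ^ k) := by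
  constructor
  · rintro ⟨C, hC, r2, h2, h⟩
    refine IsBigO.of_bound C ?_
    filter_upwards [eventually_ge_atTop r2, eventually_gt_atTop 0] with r hr hr0
    rw [Real.norm_eq_abs, Real.norm_eq_abs, abs_of_pos (zpow_pos hr0 k)]
    exact h r hr
  · intro h
    obtain ⟨C, hC, h⟩ := h.exists_pos
    have h' := h.bound
    obtain ⟨N, hN⟩ := eventually_atTop.1 (h'.and (eventually_gt_atTop 0))
    refine ⟨C, hC, max N r1, le_max_right _ _, fun r hr => ?_⟩
    obtain ⟨h1, h0⟩ := hN r (le_trans (le_max_left _ _) hr)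
    rwa [Real.norm_eq_abs, Real.norm_eq_abs, abs_of_pos (zpow_pos h0 k)] at h1

noncomputable def auxF (p : ℝ × ℝ × ℝ × ℝ) : ℝ :=
  (p.1 + p.2.1) / ((Real.sqrt (p.1 ^ 2 + p.2.2.1 ^ 2 / p.2.2.2) +
    Real.sqrt (p.2.1 ^ 2 + p.2.2.1 ^ 2 / p.2.2.2)) * Real.sqrt p.2.2.2)

lemma auxF_diff (v c : ℝ) (hc : 0 < c) :
    DifferentiableAt ℝ auxF (2, 2, v, c) := by
  have h1 : (0:ℝ) < 2 ^ 2 + v ^ 2 / c := by positivity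
  have hs : (0:ℝ) < Real.sqrt (2 ^ 2 + v ^ 2 / c) := Real.sqrt_pos.2 h1
  have hs' : (0:ℝ) < Real.sqrt c := Real.sqrt_pos.2 hc
  have hd : DifferentiableAt ℝ (fun p : ℝ × ℝ × ℝ × ℝ => p.2.2.1 ^ 2 / p.2.2.2) (2, 2, v, c) := by
    have e1 : DifferentiableAt ℝ (fun p : ℝ × ℝ × ℝ × ℝ => p.2.2.1 ^ 2) (2, 2, v, c) := by fun_prop
    have e2 : DifferentiableAt ℝ (fun p : ℝ × ℝ × ℝ × ℝ => p.2.2.2) (2, 2, v, c) := by fun_prop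
    simp only [div_eq_mul_inv]
    exact e1.fun_mul (e2.fun_inv hc.ne')
  have g1 : DifferentiableAt ℝ (fun p : ℝ × ℝ × ℝ × ℝ => p.1 ^ 2) (2, 2, v, c) := by fun_prop
  have g2 : DifferentiableAt ℝ (fun p : ℝ × ℝ × ℝ × ℝ => p.2.1 ^ 2) (2, 2, v, c) := by fun_prop
  have g3 : DifferentiableAt ℝ (fun p : ℝ × ℝ × ℝ × ℝ => p.2.2.2) (2, 2, v, c) := by fun_prop
  have g4 : DifferentiableAt ℝ (fun p : ℝ × ℝ × ℝ × ℝ => p.1 + p.2.1) (2, 2, v, c) := by fun_prop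
  have k := (((g1.fun_add hd).sqrt h1.ne').fun_add ((g2.fun_add hd).sqrt h1.ne')).fun_mul
    (g3.sqrt hc.ne')
  have k' := k.fun_inv (mul_pos (add_pos hs hs) hs').ne'
  have e : auxF = fun p => (p.1 + p.2.1) * ((Real.sqrt (p.1 ^ 2 + p.2.2.1 ^ 2 / p.2.2.2) +
    Real.sqrt (p.2.1 ^ 2 + p.2.2.1 ^ 2 / p.2.2.2)) * Real.sqrt p.2.2.2)⁻¹ := by
    funext p
    rw [auxF, div_eq_mul_inv]
  rw [e]
  exact g4.fun_mul k'

lemma auxF_val (u c A : ℝ) (hc : 0 < c) (hA : 0 < A) (h : A ^ 2 = c + u ^ 2) :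
    auxF (2, 2, 2 * u, c) = 1 / A := by
  have h1 : Real.sqrt (2 ^ 2 + (2 * u) ^ 2 / c) * Real.sqrt c = 2 * A := by
    rw [← Real.sqrt_mul (by positivity), Real.sqrt_eq_iff_mul_self_eq (by positivity) (by positivity)]
    field_simp
    nlinarith
  simp only [auxF]
  rw [add_mul, h1]
  field_simp

lemma aux_id (x y q V r : ℝ) (hr : 0 < r) (hV : 0 < V) (hx : 0 < x) (hy : 0 < y) :
    (Real.sqrt (x ^ 2 + q ^ 2 / V) - Real.sqrt (y ^ 2 + q ^ 2 / V)) / Real.sqrt V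
      = (x - y) * auxF (r * x, r * y, r * q, V) := by
  have e (z : ℝ) : Real.sqrt ((r * z) ^ 2 + (r * q) ^ 2 / V) = r * Real.sqrt (z ^ 2 + q ^ 2 / V) := by
    rw [show (r * z) ^ 2 + (r * q) ^ 2 / V = r ^ 2 * (z ^ 2 + q ^ 2 / V) by ring,
      Real.sqrt_mul (by positivity), Real.sqrt_sq hr.le]
  simp only [auxF, e]
  have s1 := Real.sq_sqrt (show 0 ≤ x ^ 2 + q ^ 2 / V by positivity)
  have s2 := Real.sq_sqrt (show 0 ≤ y ^ 2 + q ^ 2 / V by positivity)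
  have p1 := Real.sqrt_pos.2 (show 0 < x ^ 2 + q ^ 2 / V by positivity)
  have p2 := Real.sqrt_pos.2 (show 0 < y ^ 2 + q ^ 2 / V by positivity)
  have p3 := Real.sqrt_pos.2 hV
  generalize Real.sqrt (x ^ 2 + q ^ 2 / V) = S at *
  generalize Real.sqrt (y ^ 2 + q ^ 2 / V) = T at *
  have : 0 < S + T := by positivity
  field_simp
  linear_combination s1 - s2

/-- The leading coefficient `ρ⁻² = (h0⁻² − h⁻²)/a0` of the Wang–Yau mass density for the
optimal isometric embedding with time direction `T0 = (a0, a1, a2, a3)`. -/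
theorem rho_leading_coefficient (a ω : Fin 3 → ℝ) (hω : ∑ i, ω i ^ 2 = 1)
    (b0 b r0 : ℝ) (H0 H D W : ℝ → ℝ)
    (hH0 : BigO (fun r => H0 r - (2 / r + b0 / r ^ 2)) (-3) r0)
    (hH : BigO (fun r => H r - (2 / r + b / r ^ 2)) (-3) r0)
    (hD : BigO (fun r => D r - 2 * (∑ i, a i * ω i) / r) (-2) r0)
    (hW : BigO (fun r => W r -
      ((Real.sqrt (1 + ∑ i, a i ^ 2)) ^ 2 - 1 - (∑ i, a i * ω i) ^ 2)) (-1) r0) :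
    BigO (fun r =>
      (Real.sqrt (H0 r ^ 2 + D r ^ 2 / (1 + W r)) -
          Real.sqrt (H r ^ 2 + D r ^ 2 / (1 + W r))) / Real.sqrt (1 + W r)
        - (b0 - b) / (Real.sqrt (1 + ∑ i, a i ^ 2) * r ^ 2)) (-3) r0 := by
  rw [bigO_iff_aux] at hH0 hH hD hW ⊢
  set u := ∑ i, a i * ω i with hu
  set A := Real.sqrt (1 + ∑ i, a i ^ 2) with hA
  have hsum : 0 ≤ ∑ i, a i ^ 2 := Finset.sum_nonneg fun i _ => sq_nonneg _
  have hA2 : A ^ 2 = 1 + ∑ i, a i ^ 2 := Real.sq_sqrt (by positivity)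
  have hA0 : 0 < A := Real.sqrt_pos.2 (by positivity)
  have hcs : u ^ 2 ≤ ∑ i, a i ^ 2 := by
    have := Finset.sum_mul_sq_le_sq_mul_sq Finset.univ a ω
    rwa [hω, mul_one] at this
  have hc : 0 < A ^ 2 - u ^ 2 := by linarith
  set c := A ^ 2 - u ^ 2 with hcdef
  have hpos : ∀ᶠ r : ℝ in atTop, 0 < r := eventually_gt_atTop 0
  have hid : (fun r : ℝ => r) =O[atTop] (fun r : ℝ => r ^ (1:ℤ)) := by
    simpa using isBigO_refl (fun r : ℝ => r) atTop
  have mono (m n : ℤ) (h : m ≤ n) : (fun r : ℝ => r ^ m) =O[atTop] (fun r : ℝ => r ^ n) := by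
    refine IsBigO.of_bound 1 ?_
    filter_upwards [eventually_ge_atTop 1] with r hr
    have h0 : 0 < r := by linarith
    rw [one_mul, Real.norm_of_nonneg (zpow_pos h0 _).le, Real.norm_of_nonneg (zpow_pos h0 _).le]
    exact zpow_le_zpow_right₀ hr h
  have mulr {g : ℝ → ℝ} {f : ℝ → ℝ} (m n l : ℤ) (hl : m + n = l)
      (hf : f =O[atTop] (fun r : ℝ => r ^ m))
      (h : g =O[atTop] (fun r : ℝ => r ^ n)) :
      (fun r => f r * g r) =O[atTop] (fun r : ℝ => r ^ l) := by
    refine (hf.mul h).congr' EventuallyEq.rfl ?_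
    filter_upwards [hpos] with r hr
    rw [← hl, zpow_add₀ hr.ne']
  have invO (β : ℝ) : (fun r : ℝ => β / r) =O[atTop] (fun r : ℝ => r ^ (-1:ℤ)) := by
    simpa [div_eq_mul_inv] using (isBigO_refl (fun r : ℝ => r⁻¹) atTop).const_mul_left β
  have hx {G : ℝ → ℝ} {β : ℝ} (hG : (fun r => G r - (2 / r + β / r ^ 2)) =O[atTop] (fun r : ℝ => r ^ (-3:ℤ))) :
      (fun r => r * G r - 2) =O[atTop] (fun r : ℝ => r ^ (-1:ℤ)) := by
    have := ((mulr 1 (-3) (-2) (by norm_num) hid hG).trans (mono (-2) (-1) (by norm_num))).add (invO β)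
    refine this.congr' ?_ EventuallyEq.rfl
    filter_upwards [hpos] with r hr
    field_simp
    ring
  have h1 := hx hH0
  have h2 := hx hH
  have h3 : (fun r => r * D r - 2 * u) =O[atTop] (fun r : ℝ => r ^ (-1:ℤ)) := by
    refine (mulr 1 (-2) (-1) (by norm_num) hid hD).congr' ?_ EventuallyEq.rfl
    filter_upwards [hpos] with r hr
    field_simp
  have h4 : (fun r => (1 + W r) - c) =O[atTop] (fun r : ℝ => r ^ (-1:ℤ)) := by
    refine hW.congr_left fun r => ?_
    rw [hcdef]; ring
  have t0 : Tendsto (fun r : ℝ => r ^ (-1:ℤ)) atTop (𝓝 0) := by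
    simpa using tendsto_inv_atTop_zero (𝕜 := ℝ)
  have lim {G : ℝ → ℝ} {l : ℝ} (h : (fun r => G r - l) =O[atTop] (fun r : ℝ => r ^ (-1:ℤ))) :
      Tendsto G atTop (𝓝 l) := tendsto_sub_nhds_zero_iff.1 (h.trans_tendsto t0)
  have l1 := lim h1
  have l2 := lim h2
  have l4 := lim h4
  have hQ : (fun r => auxF (r * H0 r, r * H r, r * D r, 1 + W r) - 1 / A)
      =O[atTop] (fun r : ℝ => r ^ (-1:ℤ)) := by
    have hd := (auxF_diff (2 * u) c hc).isBigO_sub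
    rw [auxF_val u c A hc hA0 (by rw [hcdef]; ring)] at hd
    have ht := l1.prodMk_nhds (l2.prodMk_nhds ((lim h3).prodMk_nhds l4))
    refine (hd.comp_tendsto ht).trans ?_
    exact h1.prod_left (h2.prod_left (h3.prod_left h4))
  have hdiff : (fun r => (H0 r - H r) - (b0 - b) / r ^ 2) =O[atTop] (fun r : ℝ => r ^ (-3:ℤ)) := by
    refine (hH0.sub hH).congr_left fun r => ?_
    ring
  have hb2 : (fun r : ℝ => (b0 - b) / r ^ 2) =O[atTop] (fun r : ℝ => r ^ (-2:ℤ)) := by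
    have := (isBigO_refl (fun r : ℝ => r ^ (-2:ℤ)) atTop).const_mul_left (b0 - b)
    refine this.congr_left fun r => ?_
    rw [div_eq_mul_inv, zpow_neg]; norm_cast
  have hd2 : (fun r => H0 r - H r) =O[atTop] (fun r : ℝ => r ^ (-2:ℤ)) := by
    refine ((hdiff.trans (mono (-3) (-2) (by norm_num))).add hb2).congr_left fun r => ?_
    ring
  have fin := (mulr (-2) (-1) (-3) (by norm_num) hd2 hQ).add (hdiff.const_mul_left (1 / A))
  refine fin.congr' ?_ EventuallyEq.rfl
  filter_upwards [hpos, l1.eventually (lt_mem_nhds (show (0:ℝ) < 2 by norm_num)),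
    l2.eventually (lt_mem_nhds (show (0:ℝ) < 2 by norm_num)),
    l4.eventually (lt_mem_nhds hc)] with r hr e1 e2 e4
  rw [aux_id (H0 r) (H r) (D r) (1 + W r) r hr e4 (pos_of_mul_pos_right e1 hr.le)
    (pos_of_mul_pos_right e2 hr.le)]
  field_simp
  ring
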